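/- Let 0 < α < n + 1. Then there exists a constant C > 0 such that for all z ∈ 𝒰, ∫_𝒰 dV(u) / (|ρ(z,u)|^{n+1} |ρ(u,𝐢)|^α) ≤ (C/|ρ(z,𝐢)|^α) · (1 + log(|ρ(z,𝐢)|²/ρ(z))). -/

import Mathlib

open MeasureTheory Filter

noncomputable section

/-- Points of ℂⁿ written `z = (z′, zₙ)` with `z′ ∈ ℂ^m`, `m = n - 1`. -/
abbrev SPoint (m : ℕ) := (Fin m → ℂ) × ℂ

/-- `ρ(z,w) = (i/2)(w̄ₙ − zₙ) − z′·w̄′`. -/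
def srho2 {m : ℕ} (z w : SPoint m) : ℂ :=
  Complex.I / 2 * ((starRingEnd ℂ) w.2 - z.2) - ∑ j, z.1 j * (starRingEnd ℂ) (w.1 j)

/-- `ρ(z) = Im zₙ − |z′|²`. -/
def srho {m : ℕ} (z : SPoint m) : ℝ :=
  z.2.im - ∑ j, ‖z.1 j‖ ^ 2

/-- The Siegel upper half-space `𝒰 = {z : ρ(z) > 0}`. -/
def Siegel (m : ℕ) : Set (SPoint m) := {z | 0 < srho z}

/-- The Bergman kernel `K(z,w) = (n!/(4πⁿ)) ρ(z,w)^{−(n+1)}` (points in ℂⁿ = ℂ^{n-1} × ℂ). -/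
def sK (n : ℕ) (z w : SPoint (n - 1)) : ℂ :=
  (n.factorial : ℂ) / (4 * (Real.pi : ℂ) ^ n) * srho2 z w ^ (-(n + 1 : ℤ))

/-- Inverse hyperbolic tangent. -/
def artanh (x : ℝ) : ℝ := (1 / 2) * Real.log ((1 + x) / (1 - x))

/-- The Bergman distance `β(z,w) = artanh √(1 − ρ(z)ρ(w)/|ρ(z,w)|²)`. -/
def sbeta {m : ℕ} (z w : SPoint m) : ℝ :=
  artanh (Real.sqrt (1 - srho z * srho w / ‖srho2 z w‖ ^ 2))

/-- The Bergman metric ball `D(z,r)`. -/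
def sball {m : ℕ} (z : SPoint m) (r : ℝ) : Set (SPoint m) :=
  {w ∈ Siegel m | sbeta z w < r}

/-- Membership in the Bergman space `Aᵖ(𝒰)`: holomorphic with `∫_𝒰 |f|ᵖ dV < ∞`. -/
def MemAp (n : ℕ) (p : ℝ) (f : SPoint (n - 1) → ℂ) : Prop :=
  DifferentiableOn ℂ f (Siegel (n - 1)) ∧
    IntegrableOn (fun z => ‖f z‖ ^ p) (Siegel (n - 1)) volume

/-- `‖f‖ₚ = (∫_𝒰 |f|ᵖ dV)^{1/p}`. -/
def bNorm (n : ℕ) (p : ℝ) (f : SPoint (n - 1) → ℂ) : ℝ :=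
  (∫ z in Siegel (n - 1), ‖f z‖ ^ p) ^ (1 / p)

/-- The space `𝒮_α` of holomorphic `f` on `𝒰` with `sup_z |zₙ + i|^α |f(z)| < ∞`. -/
def SAlpha (n : ℕ) (α : ℝ) (f : SPoint (n - 1) → ℂ) : Prop :=
  DifferentiableOn ℂ f (Siegel (n - 1)) ∧
    ∃ M : ℝ, ∀ z ∈ Siegel (n - 1), ‖z.2 + Complex.I‖ ^ α * ‖f z‖ ≤ M

end

section RadialIntegrals

open Set

lemma lintegral_Ioc_zero_rpow {β c : ℝ} (hβ : -1 < β) (hc : 0 ≤ c) :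
    ∫⁻ t in Ioc 0 c, ENNReal.ofReal (t ^ β) = ENNReal.ofReal (c ^ (β + 1) / (β + 1)) := by
  rw [← ofReal_integral_eq_lintegral_ofReal, ← intervalIntegral.integral_of_le hc,
    integral_rpow (Or.inl hβ), Real.zero_rpow (by linarith), sub_zero]
  · exact (intervalIntegrable_iff_integrableOn_Ioc_of_le hc).1
      (intervalIntegral.intervalIntegrable_rpow' hβ)
  · filter_upwards [ae_restrict_mem measurableSet_Ioc] with t ht
    exact Real.rpow_nonneg ht.1.le _

lemma lintegral_Ioi_rpow {β c : ℝ} (hβ : β < -1) (hc : 0 < c) :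
    ∫⁻ t in Ioi c, ENNReal.ofReal (t ^ β) = ENNReal.ofReal (-c ^ (β + 1) / (β + 1)) := by
  rw [← ofReal_integral_eq_lintegral_ofReal, integral_Ioi_rpow_of_lt hβ hc]
  · exact integrableOn_Ioi_rpow_of_lt hβ hc
  · filter_upwards [ae_restrict_mem measurableSet_Ioi] with t ht
    exact Real.rpow_nonneg (hc.trans ht).le _

lemma lintegral_Ioc_inv {c d : ℝ} (hc : 0 < c) (hcd : c ≤ d) :
    ∫⁻ t in Ioc c d, ENNReal.ofReal t⁻¹ = ENNReal.ofReal (Real.log (d / c)) := by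
  rw [← ofReal_integral_eq_lintegral_ofReal, ← intervalIntegral.integral_of_le hcd,
    integral_inv_of_pos hc (hc.trans_le hcd)]
  · refine (intervalIntegrable_iff_integrableOn_Ioc_of_le hcd).1 ?_
    refine intervalIntegral.intervalIntegrable_inv (fun x hx => ?_) continuousOn_id
    rw [uIcc_of_le hcd] at hx
    exact (hc.trans_le hx.1).ne'
  · filter_upwards [ae_restrict_mem measurableSet_Ioc] with t ht
    exact inv_nonneg.2 (hc.trans ht.1).le

variable {X : Type*} [MeasurableSpace X] {μ : Measure X} {f : X → ℝ} {K : ENNReal} {N s : ℝ}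

/-- Layer-cake bound for negative powers of a nonnegative function. -/
lemma setLIntegral_inv_rpow_le {E : Set X} (hf : Measurable f) (hf0 : ∀ x, 0 ≤ f x)
    (hs : 0 < s) (hK : K ≠ ⊤) (w : ℝ → ENNReal)
    (hw : ∀ t, 0 < t → μ ({x | f x < t⁻¹} ∩ E) * ENNReal.ofReal (t ^ (s - 1)) ≤ K * w t) :
    ∫⁻ x in E, ENNReal.ofReal ((f x)⁻¹ ^ s) ∂μ ≤
      ENNReal.ofReal s * (K * ∫⁻ t in Ioi 0, w t) := by
  rw [lintegral_rpow_eq_lintegral_meas_lt_mul (μ.restrict E) (f := fun x => (f x)⁻¹)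
    (ae_of_all _ fun x => inv_nonneg.2 (hf0 x)) hf.inv.aemeasurable hs,
    ← lintegral_const_mul' _ _ hK]
  refine mul_le_mul_right ?_ _
  refine setLIntegral_mono' measurableSet_Ioi fun t ht => le_trans ?_ (hw t ht)
  gcongr ?_ * _
  rw [Measure.restrict_apply
    (measurableSet_lt measurable_const (show Measurable fun x => (f x)⁻¹ from hf.inv))]
  refine measure_mono (inter_subset_inter_left _ fun x hx => ?_)
  have hx' : t < (f x)⁻¹ := hx
  have h0 : 0 < f x := inv_pos.1 (lt_trans ht hx')
  exact (lt_inv_comm₀ ht h0).1 hx'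

lemma rpow_inv_mul_rpow_sub_one {t : ℝ} (ht : 0 < t) :
    ENNReal.ofReal (t⁻¹ ^ N) * ENNReal.ofReal (t ^ (s - 1)) =
      ENNReal.ofReal (t ^ (s - N - 1)) := by
  rw [← ENNReal.ofReal_mul (by positivity), Real.inv_rpow ht.le, ← Real.rpow_neg ht.le,
    ← Real.rpow_add ht]
  ring_nf

/-- Integrals of `f ^ (-s)` near the zero set of `f`, for `s` below the growth exponent. -/
lemma setLIntegral_lt_inv_rpow_le (hf : Measurable f) (hf0 : ∀ x, 0 ≤ f x) (hK : K ≠ ⊤)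
    (hμ : ∀ r, 0 < r → μ {x | f x < r} ≤ K * ENNReal.ofReal (r ^ N))
    (hs : 0 < s) (hsN : s < N) {r : ℝ} (hr : 0 < r) :
    ∫⁻ x in {x | f x < r}, ENNReal.ofReal ((f x)⁻¹ ^ s) ∂μ ≤
      K * ENNReal.ofReal (N / (N - s) * r ^ (N - s)) := by
  have hc : 0 < r⁻¹ := inv_pos.2 hr
  have hd : 0 < N - s := sub_pos.2 hsN
  refine (setLIntegral_inv_rpow_le hf hf0 hs hK
    (fun t => if t ≤ r⁻¹ then ENNReal.ofReal (r ^ N) * ENNReal.ofReal (t ^ (s - 1))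
      else ENNReal.ofReal (t ^ (s - N - 1))) fun t ht => ?_).trans ?_
  · split_ifs with h
    · rw [← mul_assoc]
      gcongr
      exact (measure_mono inter_subset_right).trans (hμ r hr)
    · rw [← rpow_inv_mul_rpow_sub_one ht, ← mul_assoc]
      gcongr
      exact (measure_mono inter_subset_left).trans (hμ _ (inv_pos.2 ht))
  · have hsplit : Ioi (0 : ℝ) = Ioc 0 r⁻¹ ∪ Ioi r⁻¹ := (Ioc_union_Ioi_eq_Ioi hc.le).symm
    rw [mul_left_comm, hsplit]
    gcongr
    refine (mul_le_mul_right (lintegral_union_le _ _ _) _).trans ?_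
    rw [setLIntegral_congr_fun (g := fun t => ENNReal.ofReal (r ^ N) * ENNReal.ofReal (t ^ (s - 1)))
        measurableSet_Ioc (fun t ht => if_pos ht.2),
      setLIntegral_congr_fun (g := fun t => ENNReal.ofReal (t ^ (s - N - 1)))
        measurableSet_Ioi (fun t ht => if_neg (not_le.2 ht)),
      lintegral_const_mul' _ _ ENNReal.ofReal_ne_top, lintegral_Ioc_zero_rpow (by linarith) hc.le,
      lintegral_Ioi_rpow (by linarith) hc, ← ENNReal.ofReal_mul (by positivity),
      ← ENNReal.ofReal_add, ← ENNReal.ofReal_mul hs.le]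
    · refine ENNReal.ofReal_le_ofReal (le_of_eq ?_)
      have e1 : r⁻¹ ^ (s - 1 + 1) = r ^ (-s) := by
        rw [Real.inv_rpow hr.le, ← Real.rpow_neg hr.le]; ring_nf
      have e2 : r⁻¹ ^ (s - N - 1 + 1) = r ^ (N - s) := by
        rw [Real.inv_rpow hr.le, ← Real.rpow_neg hr.le]; ring_nf
      have e3 : r ^ (N - s) = r ^ N * r ^ (-s) := by
        rw [← Real.rpow_add hr]; ring_nf
      rw [e1, e2, e3, sub_add_cancel, sub_add_cancel, ← neg_sub N s, neg_div_neg_eq]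
      field_simp
      ring
    · rw [sub_add_cancel]; positivity
    · rw [sub_add_cancel, ← neg_sub N s, neg_div_neg_eq]; positivity

/-- Integrals of `f ^ (-s)` away from the zero set of `f`, for `s` above the growth exponent. -/
lemma setLIntegral_ge_inv_rpow_le (hf : Measurable f) (hf0 : ∀ x, 0 ≤ f x) (hK : K ≠ ⊤)
    (hμ : ∀ r, 0 < r → μ {x | f x < r} ≤ K * ENNReal.ofReal (r ^ N))
    (hs : 0 < s) (hsN : N < s) {r : ℝ} (hr : 0 < r) :
    ∫⁻ x in {x | r ≤ f x}, ENNReal.ofReal ((f x)⁻¹ ^ s) ∂μ ≤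
      K * ENNReal.ofReal (s / (s - N) * r ^ (N - s)) := by
  have hc : 0 < r⁻¹ := inv_pos.2 hr
  refine (setLIntegral_inv_rpow_le hf hf0 hs hK
    ((Ioc 0 r⁻¹).indicator fun t => ENNReal.ofReal (t ^ (s - N - 1))) fun t ht => ?_).trans ?_
  · by_cases h : t ≤ r⁻¹
    · rw [indicator_of_mem (show t ∈ Ioc 0 r⁻¹ from ⟨ht, h⟩), ← rpow_inv_mul_rpow_sub_one ht,
        ← mul_assoc]
      gcongr
      exact (measure_mono inter_subset_left).trans (hμ _ (inv_pos.2 ht))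
    · have : {x | f x < t⁻¹} ∩ {x | r ≤ f x} = ∅ := by
        ext x
        simp only [mem_inter_iff, mem_ofPred_eq, mem_empty_iff_false, iff_false, not_and, not_le]
        exact fun hx => hx.trans ((inv_lt_comm₀ hr ht).1 (not_le.1 h))
      simp [this]
  · rw [mul_left_comm]
    gcongr
    rw [setLIntegral_indicator measurableSet_Ioc,
      inter_eq_left.2 (show Ioc 0 r⁻¹ ⊆ Ioi (0 : ℝ) from fun t ht => ht.1),
      lintegral_Ioc_zero_rpow (by linarith) hc.le, ← ENNReal.ofReal_mul hs.le]
    refine ENNReal.ofReal_le_ofReal (le_of_eq ?_)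
    rw [Real.inv_rpow hr.le, ← Real.rpow_neg hr.le]
    ring_nf

/-- At the growth exponent the integral over an annulus is logarithmic. -/
lemma setLIntegral_annulus_inv_rpow_le (hf : Measurable f) (hf0 : ∀ x, 0 ≤ f x) (hK : K ≠ ⊤)
    (hμ : ∀ r, 0 < r → μ {x | f x < r} ≤ K * ENNReal.ofReal (r ^ N))
    (hN : 0 < N) {a b : ℝ} (ha : 0 < a) (hab : a ≤ b) :
    ∫⁻ x in {x | a ≤ f x ∧ f x < b}, ENNReal.ofReal ((f x)⁻¹ ^ N) ∂μ ≤
      K * ENNReal.ofReal (1 + N * Real.log (b / a)) := by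
  have hb : 0 < b := ha.trans_le hab
  have hc : 0 < b⁻¹ := inv_pos.2 hb
  have hcd : b⁻¹ ≤ a⁻¹ := inv_anti₀ ha hab
  have hlog : 0 ≤ Real.log (b / a) := Real.log_nonneg ((one_le_div ha).2 hab)
  refine (setLIntegral_inv_rpow_le hf hf0 hN hK
    (fun t => (Ioc 0 b⁻¹).indicator
        (fun t => ENNReal.ofReal (b ^ N) * ENNReal.ofReal (t ^ (N - 1))) t +
      (Ioc b⁻¹ a⁻¹).indicator (fun t => ENNReal.ofReal t⁻¹) t) fun t ht => ?_).trans ?_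
  · by_cases h : t ≤ b⁻¹
    · rw [indicator_of_mem (show t ∈ Ioc 0 b⁻¹ from ⟨ht, h⟩),
        indicator_of_notMem (fun h' => (not_lt.2 h) h'.1), add_zero, ← mul_assoc]
      gcongr
      exact (measure_mono (inter_subset_right.trans fun x hx => hx.2)).trans (hμ b hb)
    by_cases h' : t ≤ a⁻¹
    · rw [indicator_of_mem (show t ∈ Ioc b⁻¹ a⁻¹ from ⟨not_le.1 h, h'⟩),
        indicator_of_notMem (fun hh => h hh.2), zero_add]
      have : ENNReal.ofReal t⁻¹ = ENNReal.ofReal (t ^ (N - N - 1)) := by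
        rw [sub_self, zero_sub, Real.rpow_neg_one]
      rw [this, ← rpow_inv_mul_rpow_sub_one ht, ← mul_assoc]
      gcongr
      exact (measure_mono inter_subset_left).trans (hμ _ (inv_pos.2 ht))
    · have : {x | f x < t⁻¹} ∩ {x | a ≤ f x ∧ f x < b} = ∅ := by
        ext x
        simp only [mem_inter_iff, mem_ofPred_eq, mem_empty_iff_false, iff_false, not_and]
        exact fun hx hx' => absurd hx'
          (not_le.2 (hx.trans ((inv_lt_comm₀ ha ht).1 (not_le.1 h'))))
      simp [this]
  · rw [mul_left_comm]
    gcongr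
    rw [lintegral_add_left ((by fun_prop : Measurable fun t : ℝ =>
        ENNReal.ofReal (b ^ N) * ENNReal.ofReal (t ^ (N - 1))).indicator measurableSet_Ioc),
      setLIntegral_indicator measurableSet_Ioc, setLIntegral_indicator measurableSet_Ioc,
      inter_eq_left.2 (show Ioc 0 b⁻¹ ⊆ Ioi (0 : ℝ) from fun t ht => ht.1),
      inter_eq_left.2 (show Ioc b⁻¹ a⁻¹ ⊆ Ioi (0 : ℝ) from fun t ht => hc.trans ht.1),
      lintegral_const_mul' _ _ ENNReal.ofReal_ne_top, lintegral_Ioc_zero_rpow (by linarith) hc.le,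
      lintegral_Ioc_inv hc hcd, inv_div_inv, sub_add_cancel, ← ENNReal.ofReal_mul (by positivity),
      ← ENNReal.ofReal_add (by positivity) hlog, ← ENNReal.ofReal_mul hN.le]
    refine ENNReal.ofReal_le_ofReal (le_of_eq ?_)
    rw [Real.inv_rpow hb.le]
    field_simp

end RadialIntegrals

section SiegelGeometry

variable {m : ℕ} {z u : SPoint m}

lemma continuous_srho2 (z : SPoint m) : Continuous fun u => srho2 z u := by
  unfold srho2
  fun_prop

lemma continuous_srho : Continuous fun u : SPoint m => srho u := by
  unfold srho
  fun_prop

lemma measurableSet_Siegel : MeasurableSet (Siegel m) :=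
  (isOpen_lt continuous_const continuous_srho).measurableSet

lemma norm_srho2_comm (z u : SPoint m) : ‖srho2 z u‖ = ‖srho2 u z‖ := by
  rw [← Complex.norm_conj]
  congr 1
  simp only [srho2, map_sub, map_mul, map_sum, map_div₀, Complex.conj_conj, Complex.conj_I,
    map_ofNat, mul_comm]
  ring

lemma srho2_re (z u : SPoint m) :
    (srho2 z u).re = (srho z + srho u + ∑ j, ‖u.1 j - z.1 j‖ ^ 2) / 2 := by
  have h : ∑ j, ‖u.1 j - z.1 j‖ ^ 2 =
      ∑ j, ‖z.1 j‖ ^ 2 + ∑ j, ‖u.1 j‖ ^ 2 - 2 * ∑ j, (z.1 j * (starRingEnd ℂ) (u.1 j)).re := by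
    rw [Finset.mul_sum, ← Finset.sum_add_distrib, ← Finset.sum_sub_distrib]
    refine Finset.sum_congr rfl fun j _ => ?_
    simp only [← Complex.normSq_eq_norm_sq, Complex.normSq_apply, Complex.sub_re, Complex.sub_im,
      Complex.mul_re, Complex.conj_re, Complex.conj_im]
    ring
  rw [h]
  simp only [srho2, srho, Complex.sub_re, Complex.re_sum, Complex.mul_re, Complex.div_ofNat_re,
    Complex.div_ofNat_im, Complex.I_re, Complex.I_im, Complex.sub_im, Complex.conj_im,
    Complex.conj_re]
  ring

lemma srho2_im (z u : SPoint m) :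
    (srho2 z u).im = (u.2.re - z.2.re) / 2 - (∑ j, z.1 j * (starRingEnd ℂ) (u.1 j)).im := by
  simp only [srho2, Complex.sub_re, Complex.sub_im, Complex.mul_im, Complex.div_ofNat_re,
    Complex.div_ofNat_im, Complex.I_re, Complex.I_im, Complex.conj_im,
    Complex.conj_re]
  ring

lemma srho_add_le (z u : SPoint m) :
    srho z + srho u + ∑ j, ‖u.1 j - z.1 j‖ ^ 2 ≤ 2 * ‖srho2 z u‖ := by
  have h := Complex.re_le_norm (srho2 z u)
  rw [srho2_re] at h
  linarith

/-- Non-isotropic balls of radius `r` have volume `O(r ^ (m + 2))`, uniformly in the centre. -/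
lemma volume_norm_srho2_lt_le (hz : z ∈ Siegel m) {r : ℝ} (hr : 0 < r) :
    (volume.restrict (Siegel m)) {u | ‖srho2 z u‖ < r} ≤
      ENNReal.ofReal (16 * Real.pi * (2 * Real.pi) ^ m) * ENNReal.ofReal (r ^ ((m : ℝ) + 2)) := by
  have hz' : 0 < srho z := hz
  have hM : MeasurableSet {u : SPoint m | ‖srho2 z u‖ < r} :=
    (isOpen_lt (continuous_srho2 z).norm continuous_const).measurableSet
  let B := Metric.closedBall z.1 (√(2 * r))
  let c : (Fin m → ℂ) → ℂ := fun v =>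
    ⟨z.2.re + 2 * (∑ j, z.1 j * (starRingEnd ℂ) (v j)).im, ∑ j, ‖v j‖ ^ 2⟩
  have hsec : ∀ v, volume (Prod.mk v ⁻¹' ({u | ‖srho2 z u‖ < r} ∩ Siegel m)) ≤
      B.indicator (fun _ => ENNReal.ofReal (16 * Real.pi * r ^ 2)) v := by
    intro v
    have key : ∀ t, (v, t) ∈ {u | ‖srho2 z u‖ < r} ∩ Siegel m →
        v ∈ B ∧ t ∈ Metric.closedBall (c v) (4 * r) := by
      rintro t ⟨h1, h2⟩
      have h1 : ‖srho2 z (v, t)‖ < r := h1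
      have h2 : 0 < srho (v, t) := h2
      have h3 := srho_add_le z (v, t)
      have hS : 0 ≤ ∑ j, ‖v j - z.1 j‖ ^ 2 := Finset.sum_nonneg fun _ _ => by positivity
      simp only at h3
      refine ⟨?_, ?_⟩
      · rw [Metric.mem_closedBall, dist_pi_le_iff (by positivity)]
        intro j
        rw [dist_eq_norm]
        refine Real.le_sqrt_of_sq_le ?_
        have := Finset.single_le_sum (f := fun j => ‖v j - z.1 j‖ ^ 2)
          (fun _ _ => by positivity) (Finset.mem_univ j)
        linarith
      · rw [Metric.mem_closedBall, dist_eq_norm]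
        refine (Complex.norm_le_abs_re_add_abs_im _).trans ?_
        have h4 := (Complex.abs_im_le_norm (srho2 z (v, t))).trans h1.le
        rw [srho2_im, abs_le] at h4
        have h5 : (t - c v).im = srho (v, t) := rfl
        have h6 : |(t - c v).re| ≤ 2 * r := by
          simp only [Complex.sub_re, c]
          rw [abs_le]
          constructor <;> linarith [h4.1, h4.2]
        rw [h5, abs_of_pos h2]
        linarith
    by_cases hv : v ∈ B
    · rw [Set.indicator_of_mem hv]
      refine (measure_mono fun t ht => (key t ht).2).trans (le_of_eq ?_)
      rw [Complex.volume_closedBall, ← ENNReal.ofReal_pow (by positivity),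
        ← ENNReal.ofReal_coe_nnreal, ← ENNReal.ofReal_mul (by positivity), NNReal.coe_real_pi]
      congr 1
      ring
    · rw [Set.indicator_of_notMem hv]
      have : Prod.mk v ⁻¹' ({u | ‖srho2 z u‖ < r} ∩ Siegel m) = ∅ :=
        Set.eq_empty_of_forall_notMem fun t ht => hv (key t ht).1
      simp [this]
  rw [Measure.restrict_apply hM, Measure.volume_eq_prod,
    Measure.prod_apply (hM.inter measurableSet_Siegel)]
  refine (lintegral_mono hsec).trans (le_of_eq ?_)
  rw [lintegral_indicator_const Metric.isClosed_closedBall.measurableSet,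
    MeasureTheory.volume_pi_closedBall _ (by positivity)]
  simp only [Complex.volume_closedBall, Finset.prod_const, Finset.card_univ, Fintype.card_fin]
  rw [← ENNReal.ofReal_pow (by positivity), ← ENNReal.ofReal_coe_nnreal,
    ← ENNReal.ofReal_mul (by positivity), ← ENNReal.ofReal_pow (by positivity),
    ← ENNReal.ofReal_mul (by positivity), ← ENNReal.ofReal_mul (by positivity),
    Real.sq_sqrt (by positivity), NNReal.coe_real_pi]
  congr 1
  rw [Real.rpow_add hr, Real.rpow_natCast, Real.rpow_two]
  ring

lemma norm_srho2_I (z : SPoint m) :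
    ‖srho2 z ((0 : Fin m → ℂ), Complex.I)‖ = ‖z.2 + Complex.I‖ / 2 := by
  have : srho2 z ((0 : Fin m → ℂ), Complex.I) = -(Complex.I / 2) * (z.2 + Complex.I) := by
    simp only [srho2, Complex.conj_I, Pi.zero_apply, map_zero, mul_zero, Finset.sum_const_zero]
    ring
  rw [this]
  simp
  ring

lemma I_mem_Siegel : ((0 : Fin m → ℂ), Complex.I) ∈ Siegel m := by
  simp [Siegel, srho]

lemma sum_sq_lt_im (hz : z ∈ Siegel m) : ∑ j, ‖z.1 j‖ ^ 2 < z.2.im :=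
  sub_pos.1 hz

lemma im_pos_of_mem_Siegel (hz : z ∈ Siegel m) : 0 < z.2.im :=
  (Finset.sum_nonneg fun _ _ => by positivity).trans_lt (sum_sq_lt_im hz)

lemma im_add_one_le (z : SPoint m) :
    z.2.im + 1 ≤ 2 * ‖srho2 z ((0 : Fin m → ℂ), Complex.I)‖ := by
  have h := (le_abs_self _).trans (Complex.abs_im_le_norm (z.2 + Complex.I))
  rw [norm_srho2_I]
  simp only [Complex.add_im, Complex.I_im] at h
  linarith

lemma norm_sum_mul_conj_le (z u : SPoint m) :
    ‖∑ j, z.1 j * (starRingEnd ℂ) (u.1 j)‖ ≤ ∑ j, ‖z.1 j‖ * ‖u.1 j‖ :=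
  (norm_sum_le _ _).trans (by simp)

/-- Quasi-triangle inequality through the base point. -/
lemma norm_srho2_le_add (hz : z ∈ Siegel m) (hu : u ∈ Siegel m) :
    ‖srho2 z u‖ ≤ 3 * (‖srho2 u ((0 : Fin m → ℂ), Complex.I)‖ +
      ‖srho2 z ((0 : Fin m → ℂ), Complex.I)‖) := by
  have h1 : srho2 z u = Complex.I / 2 * ((starRingEnd ℂ) (u.2 + Complex.I))
      - Complex.I / 2 * (z.2 + Complex.I) - 1 - ∑ j, z.1 j * (starRingEnd ℂ) (u.1 j) := by
    simp only [srho2, map_add, Complex.conj_I]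
    ring_nf
    simp only [Complex.I_sq]
    ring
  have h2 : ‖srho2 z u‖ ≤ ‖u.2 + Complex.I‖ / 2 + ‖z.2 + Complex.I‖ / 2 + 1 +
      ‖∑ j, z.1 j * (starRingEnd ℂ) (u.1 j)‖ := by
    rw [h1]
    refine (norm_sub_le _ _).trans (add_le_add_left ((norm_sub_le _ _).trans
      (add_le_add ((norm_sub_le _ _).trans (le_of_eq ?_)) (by simp))) _)
    simp only [norm_mul, norm_div, Complex.norm_I, Complex.norm_ofNat, Complex.norm_conj]
    ring
  have h3 : ∑ j, ‖z.1 j‖ * ‖u.1 j‖ ≤ (∑ j, ‖z.1 j‖ ^ 2 + ∑ j, ‖u.1 j‖ ^ 2) / 2 := by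
    rw [← Finset.sum_add_distrib, Finset.sum_div]
    exact Finset.sum_le_sum fun j _ => by nlinarith [sq_nonneg (‖z.1 j‖ - ‖u.1 j‖)]
  rw [← norm_srho2_I, ← norm_srho2_I] at h2
  linarith [norm_sum_mul_conj_le z u, sum_sq_lt_im hz, sum_sq_lt_im hu, im_add_one_le z,
    im_add_one_le u, im_pos_of_mem_Siegel hz, im_pos_of_mem_Siegel hu]

/-- Quasi-triangle inequality to the base point. -/
lemma norm_srho2_I_le_add (hz : z ∈ Siegel m) (hu : u ∈ Siegel m) :
    ‖srho2 z ((0 : Fin m → ℂ), Complex.I)‖ ≤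
      6 * (‖srho2 z u‖ + ‖srho2 u ((0 : Fin m → ℂ), Complex.I)‖) := by
  have h1 : Complex.I / 2 * (z.2 + Complex.I) = Complex.I / 2 * (u.2 + Complex.I) - srho2 z u
      - ∑ j, z.1 j * (starRingEnd ℂ) (u.1 j) + u.2.im := by
    have : u.2 = (starRingEnd ℂ) u.2 + 2 * u.2.im * Complex.I := by
      apply Complex.ext <;> simp
      ring
    have h : Complex.I / 2 * u.2 = Complex.I / 2 * (starRingEnd ℂ) u.2 - u.2.im := by
      conv_lhs => rw [this]
      ring_nf
      simp only [Complex.I_sq]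
      ring
    rw [mul_add _ u.2, h]
    simp only [srho2]
    ring
  have h2 : ‖z.2 + Complex.I‖ / 2 ≤ ‖u.2 + Complex.I‖ / 2 + ‖srho2 z u‖ +
      ‖∑ j, z.1 j * (starRingEnd ℂ) (u.1 j)‖ + u.2.im := by
    have e : ‖Complex.I / 2 * (z.2 + Complex.I)‖ = ‖z.2 + Complex.I‖ / 2 := by
      simp only [norm_mul, norm_div, Complex.norm_I, Complex.norm_ofNat]
      ring
    rw [← e, h1]
    refine (norm_add_le _ _).trans (add_le_add ((norm_sub_le _ _).trans
      (add_le_add_left ((norm_sub_le _ _).trans (le_of_eq ?_)) _)) ?_)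
    · simp only [norm_mul, norm_div, Complex.norm_I, Complex.norm_ofNat]
      ring
    · rw [Complex.norm_real, Real.norm_of_nonneg (im_pos_of_mem_Siegel hu).le]
  have h3 : ∑ j, ‖z.1 j‖ * ‖u.1 j‖ ≤
      (3 * ∑ j, ‖u.1 j‖ ^ 2 + ∑ j, ‖u.1 j - z.1 j‖ ^ 2) / 2 := by
    rw [Finset.mul_sum, ← Finset.sum_add_distrib, Finset.sum_div]
    refine Finset.sum_le_sum fun j _ => ?_
    have : ‖z.1 j‖ ≤ ‖u.1 j‖ + ‖u.1 j - z.1 j‖ := by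
      have := norm_sub_le (u.1 j) (u.1 j - z.1 j)
      rwa [sub_sub_cancel] at this
    nlinarith [sq_nonneg (‖u.1 j‖ - ‖u.1 j - z.1 j‖), norm_nonneg (u.1 j)]
  rw [← norm_srho2_I, ← norm_srho2_I] at h2
  have hz0 : 0 < srho z := hz
  have hu0 : 0 < srho u := hu
  linarith [norm_sum_mul_conj_le z u, sum_sq_lt_im hu, srho_add_le z u,
    im_add_one_le u, im_pos_of_mem_Siegel hu, norm_nonneg (srho2 z u)]

end SiegelGeometry

section LogIntegral

/-- The pointwise comparison behind the splitting of the integral into three regions. -/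
lemma one_div_rpow_mul_rpow_le {N α p q R a : ℝ} (hN : 0 < N) (hα : 0 < α) (hp : 0 < p)
    (hq : 0 < q) (hR : 0 < R) (hap : a ≤ p) (hRpq : R ≤ 6 * (p + q)) (hpq : p ≤ 3 * (q + R)) :
    (q < R / 12 ∧ 1 / (p ^ N * q ^ α) ≤ (R / 12)⁻¹ ^ N * q⁻¹ ^ α) ∨
    ((a ≤ p ∧ p < 6 * R) ∧ 1 / (p ^ N * q ^ α) ≤ (R / 12)⁻¹ ^ α * p⁻¹ ^ N) ∨
    (6 * R ≤ p ∧ 1 / (p ^ N * q ^ α) ≤ 6 ^ α * p⁻¹ ^ (N + α)) := by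
  have e : 1 / (p ^ N * q ^ α) = p⁻¹ ^ N * q⁻¹ ^ α := by
    rw [Real.inv_rpow hp.le, Real.inv_rpow hq.le, one_div, mul_inv]
  rw [e]
  rcases lt_or_ge q (R / 12) with h | h
  · refine Or.inl ⟨h, ?_⟩
    gcongr
    linarith
  rcases lt_or_ge p (6 * R) with h' | h'
  · refine Or.inr (Or.inl ⟨⟨hap, h'⟩, ?_⟩)
    rw [mul_comm]
    gcongr
  · refine Or.inr (Or.inr ⟨h', ?_⟩)
    rw [Real.rpow_add (inv_pos.2 hp), mul_left_comm, ← Real.mul_rpow (by norm_num) (by positivity)]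
    gcongr
    rw [← div_eq_mul_inv, inv_eq_one_div, div_le_div_iff₀ hq hp]
    linarith

variable {m : ℕ}

lemma lintegral_Siegel_le {α : ℝ} (hα0 : 0 < α) (hα1 : α < (m : ℝ) + 2) {z : SPoint m}
    (hz : z ∈ Siegel m) {R : ℝ} (hR : R = ‖srho2 z ((0 : Fin m → ℂ), Complex.I)‖) :
    ∫⁻ u in Siegel m, ENNReal.ofReal (1 / (‖srho2 z u‖ ^ ((m : ℝ) + 2) *
        ‖srho2 u ((0 : Fin m → ℂ), Complex.I)‖ ^ α)) ≤
      ENNReal.ofReal (16 * Real.pi * (2 * Real.pi) ^ m * R ^ (-α) *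
        (12 ^ α * (((m : ℝ) + 2) / ((m : ℝ) + 2 - α)) +
          12 ^ α * (1 + ((m : ℝ) + 2) * Real.log (12 * R / srho z)) +
            ((m : ℝ) + 2 + α) / α)) := by
  set N : ℝ := (m : ℝ) + 2 with hN
  have hN0 : 0 < N := by positivity
  have hNα : 0 < N - α := sub_pos.2 hα1
  have hz0 : 0 < srho z := hz
  have hρ : srho z ≤ z.2.im := sub_le_self _ (Finset.sum_nonneg fun _ _ => by positivity)
  have hRim : z.2.im + 1 ≤ 2 * R := hR ▸ im_add_one_le z
  have hR0 : 0 < R := by linarith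
  set p : SPoint m → ℝ := fun u => ‖srho2 z u‖ with hp
  set q : SPoint m → ℝ := fun u => ‖srho2 ((0 : Fin m → ℂ), Complex.I) u‖ with hq
  have hpm : Measurable p := (continuous_srho2 z).norm.measurable
  have hqm : Measurable q := (continuous_srho2 _).norm.measurable
  set A : ℝ := 16 * Real.pi * (2 * Real.pi) ^ m with hA
  have hA0 : 0 < A := by positivity
  have hlog : 0 ≤ Real.log (12 * R / srho z) :=
    Real.log_nonneg ((one_le_div hz0).2 (by linarith))
  have hS3 : MeasurableSet {u | q u < R / 12} := measurableSet_lt hqm measurable_const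
  have hS1 : MeasurableSet {u | srho z / 2 ≤ p u ∧ p u < 6 * R} :=
    (measurableSet_le measurable_const hpm).inter (measurableSet_lt hpm measurable_const)
  have hS2 : MeasurableSet {u | 6 * R ≤ p u} := measurableSet_le measurable_const hpm
  have I3 := setLIntegral_lt_inv_rpow_le hqm (fun _ => norm_nonneg _) ENNReal.ofReal_ne_top
    (fun r hr => volume_norm_srho2_lt_le I_mem_Siegel hr) hα0 hα1 (r := R / 12) (by positivity)
  have I1 := setLIntegral_annulus_inv_rpow_le hpm (fun _ => norm_nonneg _) ENNReal.ofReal_ne_top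
    (fun r hr => volume_norm_srho2_lt_le hz hr) hN0 (a := srho z / 2) (b := 6 * R)
    (by positivity) (by linarith)
  have I2 := setLIntegral_ge_inv_rpow_le hpm (fun _ => norm_nonneg _) ENNReal.ofReal_ne_top
    (fun r hr => volume_norm_srho2_lt_le hz hr) (s := N + α) (by positivity) (by linarith)
    (r := 6 * R) (by positivity)
  have hpt : ∀ u ∈ Siegel m, ENNReal.ofReal (1 / (‖srho2 z u‖ ^ N *
        ‖srho2 u ((0 : Fin m → ℂ), Complex.I)‖ ^ α)) ≤
      {u | q u < R / 12}.indicator (fun u => ENNReal.ofReal ((R / 12)⁻¹ ^ N) *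
          ENNReal.ofReal ((q u)⁻¹ ^ α)) u +
      ({u | srho z / 2 ≤ p u ∧ p u < 6 * R}.indicator (fun u =>
          ENNReal.ofReal ((R / 12)⁻¹ ^ α) * ENNReal.ofReal ((p u)⁻¹ ^ N)) u +
        {u | 6 * R ≤ p u}.indicator (fun u =>
          ENNReal.ofReal (6 ^ α) * ENNReal.ofReal ((p u)⁻¹ ^ (N + α))) u) := by
    intro u hu
    have hu0 : 0 < srho u := hu
    have hdiff : 0 ≤ ∑ j, ‖u.1 j - z.1 j‖ ^ 2 := Finset.sum_nonneg fun _ _ => by positivity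
    have hle := srho_add_le z u
    have hqu : ‖srho2 u ((0 : Fin m → ℂ), Complex.I)‖ = q u := norm_srho2_comm _ _
    have hpz : srho z / 2 ≤ p u := by simp only [hp]; linarith
    have hq0 : 0 < q u := by
      have := im_add_one_le u
      have := im_pos_of_mem_Siegel hu
      rw [← hqu]
      linarith
    have t1 := norm_srho2_I_le_add hz hu
    have t2 := norm_srho2_le_add hz hu
    rw [hqu, ← hR] at t1 t2
    rw [hqu]
    rcases one_div_rpow_mul_rpow_le hN0 hα0 (by linarith : 0 < p u) hq0 hR0 hpz t1 t2 with
      ⟨hmem, h⟩ | ⟨hmem, h⟩ | ⟨hmem, h⟩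
    · refine le_trans ?_ le_self_add
      rw [Set.indicator_of_mem (by exact hmem), ← ENNReal.ofReal_mul (by positivity)]
      exact ENNReal.ofReal_le_ofReal h
    · refine le_trans ?_ (le_add_self.trans' le_self_add)
      rw [Set.indicator_of_mem (by exact hmem), ← ENNReal.ofReal_mul (by positivity)]
      exact ENNReal.ofReal_le_ofReal h
    · refine le_trans ?_ (le_add_self.trans' le_add_self)
      rw [Set.indicator_of_mem (by exact hmem), ← ENNReal.ofReal_mul (by positivity)]
      exact ENNReal.ofReal_le_ofReal h
  refine (setLIntegral_mono' measurableSet_Siegel hpt).trans ?_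
  rw [lintegral_add_left (Measurable.indicator (by fun_prop) hS3),
    lintegral_add_left (Measurable.indicator (by fun_prop) hS1),
    lintegral_indicator hS3, lintegral_indicator hS1, lintegral_indicator hS2,
    lintegral_const_mul' _ _ ENNReal.ofReal_ne_top, lintegral_const_mul' _ _ ENNReal.ofReal_ne_top,
    lintegral_const_mul' _ _ ENNReal.ofReal_ne_top]
  refine (add_le_add (mul_le_mul_right I3 _)
    (add_le_add (mul_le_mul_right I1 _) (mul_le_mul_right I2 _))).trans (le_of_eq ?_)
  have hba : 6 * R / (srho z / 2) = 12 * R / srho z := by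
    field_simp
    norm_num
  rw [← hN, ← hA, hba, add_sub_cancel_left, sub_add_cancel_left]
  have hS : 0 < R / 12 := by positivity
  have e1 : (R / 12)⁻¹ ^ N * (R / 12) ^ (N - α) = 12 ^ α * R ^ (-α) := by
    rw [Real.inv_rpow hS.le, ← Real.rpow_neg hS.le, ← Real.rpow_add hS,
      show -N + (N - α) = -α by ring, Real.div_rpow hR0.le (by norm_num),
      Real.rpow_neg (by norm_num : (0 : ℝ) ≤ 12), div_inv_eq_mul, mul_comm]
  have e2 : (R / 12)⁻¹ ^ α = 12 ^ α * R ^ (-α) := by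
    rw [Real.inv_rpow hS.le, ← Real.rpow_neg hS.le, Real.div_rpow hR0.le (by norm_num),
      Real.rpow_neg (by norm_num : (0 : ℝ) ≤ 12), div_inv_eq_mul, mul_comm]
  have e3 : (6 : ℝ) ^ α * (6 * R) ^ (-α) = R ^ (-α) := by
    rw [Real.mul_rpow (by norm_num) hR0.le, ← mul_assoc, ← Real.rpow_add (by norm_num)]
    simp
  simp only [← ENNReal.ofReal_mul hA0.le]
  rw [← ENNReal.ofReal_mul (by positivity), ← ENNReal.ofReal_mul (by positivity),
    ← ENNReal.ofReal_mul (by positivity), ← ENNReal.ofReal_add (by positivity) (by positivity),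
    ← ENNReal.ofReal_add (by positivity) (by positivity)]
  congr 1
  linear_combination (A * (N / (N - α))) * e1 +
    (A * (1 + N * Real.log (12 * R / srho z))) * e2 + (A * ((N + α) / α)) * e3

lemma log_le_log_sq_div {R ρ : ℝ} (hρ : 0 < ρ) (hR : 1 / 2 ≤ R) :
    Real.log (12 * R / ρ) ≤ Real.log 24 + Real.log (R ^ 2 / ρ) := by
  have hR0 : 0 < R := by linarith
  rw [← Real.log_mul (by norm_num) (by positivity), ← mul_div_assoc]
  refine Real.log_le_log (by positivity) (div_le_div_of_nonneg_right ?_ hρ.le)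
  nlinarith

end LogIntegral

/-- for `0 < α < n + 1` there is `C > 0` with
`∫_𝒰 dV(u)/(|ρ(z,u)|^{n+1} |ρ(u,𝐢)|^α) ≤ (C/|ρ(z,𝐢)|^α)(1 + log(|ρ(z,𝐢)|²/ρ(z)))`. -/
theorem log_integral_estimate (n : ℕ) (hn : 1 ≤ n) (α : ℝ) (hα0 : 0 < α)
    (hα1 : α < (n : ℝ) + 1) :
    ∃ C : ℝ, 0 < C ∧ ∀ z ∈ Siegel (n - 1),
      ∫⁻ u in Siegel (n - 1),
          ENNReal.ofReal (1 /
            (‖srho2 z u‖ ^ ((n : ℝ) + 1) *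
              ‖srho2 u ((0 : Fin (n - 1) → ℂ), Complex.I)‖ ^ α)) ≤
        ENNReal.ofReal
          (C / ‖srho2 z ((0 : Fin (n - 1) → ℂ), Complex.I)‖ ^ α *
            (1 + Real.log
              (‖srho2 z ((0 : Fin (n - 1) → ℂ), Complex.I)‖ ^ 2 / srho z))) := by
  obtain ⟨m, rfl⟩ : ∃ m, n = m + 1 := ⟨n - 1, by omega⟩
  have hcast : ((m + 1 : ℕ) : ℝ) + 1 = (m : ℝ) + 2 := by push_cast; ring
  rw [hcast] at hα1 ⊢
  rw [Nat.add_sub_cancel]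
  have hlog24 : 0 < Real.log 24 := Real.log_pos (by norm_num)
  have hNα : 0 < (m : ℝ) + 2 - α := sub_pos.2 hα1
  set N : ℝ := (m : ℝ) + 2
  have hN0 : 0 < N := by positivity
  refine ⟨16 * Real.pi * (2 * Real.pi) ^ m * (12 ^ α * (N / (N - α)) +
    12 ^ α * (1 + N * Real.log 24 + N) + (N + α) / α), by positivity, fun z hz => ?_⟩
  have hz0 : 0 < srho z := hz
  have hρ : srho z ≤ z.2.im := sub_le_self _ (Finset.sum_nonneg fun _ _ => by positivity)
  have hRim := im_add_one_le z
  refine (lintegral_Siegel_le hα0 hα1 hz rfl).trans (ENNReal.ofReal_le_ofReal ?_)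
  set R := ‖srho2 z ((0 : Fin m → ℂ), Complex.I)‖
  have hR0 : 0 < R := by linarith
  have hL : 0 ≤ Real.log (R ^ 2 / srho z) :=
    Real.log_nonneg ((one_le_div hz0).2 (by nlinarith [sq_nonneg (R - 1)]))
  have hlog := log_le_log_sq_div hz0 (by linarith : 1 / 2 ≤ R)
  set L := Real.log (R ^ 2 / srho z)
  rw [Real.rpow_neg hR0.le, ← div_eq_mul_inv, div_mul_eq_mul_div, div_mul_eq_mul_div,
    mul_assoc _ _ (1 + L)]
  refine div_le_div_of_nonneg_right (mul_le_mul_of_nonneg_left ?_ (by positivity)) (by positivity)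
  calc _ ≤ 12 ^ α * (N / (N - α)) + 12 ^ α * (1 + N * (Real.log 24 + L)) + (N + α) / α := by
        gcongr
    _ ≤ _ := by
        have h1 : 0 ≤ 12 ^ α * (N / (N - α)) * L := by positivity
        have h2 : 0 ≤ (12 : ℝ) ^ α * (1 + N * Real.log 24) * L := by positivity
        have h3 : 0 ≤ (N + α) / α * L := by positivity
        have h4 : 0 ≤ (12 : ℝ) ^ α * N := by positivity
        linarith
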